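/- arXiv:1506.05087 — 5 statements merged into one kernel-verified Lean document; each statement's English description precedes it below -/
import Mathlib

section
/- Let W, W', V be real normed vector spaces, let G : W × V → W' be Lipschitz with constant C₂ ≥ 0, and let H : W' × V → W satisfy G(H(z,v), v) = z and H(G(w,v), v) = w for all w, z, v, with each partial map z ↦ H(z,v) Lipschitz with constant C₁ ≥ 0. Then for every g ∈ W', the fiber {(w,v) ∈ W × V : G(w,v) = g} is exactly the graph {(H(g,v), v) : v ∈ V} of the map v ↦ H(g,v), and this map is Lipschitz with constant C₁·C₂, independent of g. -/
/-- Fibers are uniformly steep Lipschitz graphs: for every `g`, the fiber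
`{(w,v) : G(w,v) = g}` is the graph of `v ↦ H(g,v)`, and this map is Lipschitz with
constant `C₁·C₂`, independent of `g`. -/
theorem fibers_are_lipschitz_graphs
    {W W' V : Type*} [NormedAddCommGroup W] [NormedSpace ℝ W]
    [NormedAddCommGroup W'] [NormedSpace ℝ W']
    [NormedAddCommGroup V] [NormedSpace ℝ V]
    (G : W × V → W') (H : W' × V → W) (C₁ C₂ : ℝ) (hC₁ : 0 ≤ C₁) (hC₂ : 0 ≤ C₂)
    (hG : ∀ p q : W × V, ‖G p - G q‖ ≤ C₂ * (‖p.1 - q.1‖ + ‖p.2 - q.2‖))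
    (hGH : ∀ (z : W') (v : V), G (H (z, v), v) = z)
    (hHG : ∀ (w : W) (v : V), H (G (w, v), v) = w)
    (hH : ∀ (z z' : W') (v : V), ‖H (z, v) - H (z', v)‖ ≤ C₁ * ‖z - z'‖) :
    ∀ g : W',
      {p : W × V | G p = g} = Set.range (fun v : V => (H (g, v), v)) ∧
      (∀ v v' : V, ‖H (g, v) - H (g, v')‖ ≤ C₁ * C₂ * ‖v - v'‖) := by
  intro g
  refine ⟨?_, fun v v' => ?_⟩
  · ext ⟨w, v⟩
    simp only [Set.mem_setOf_eq, Set.mem_range, Prod.mk.injEq]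
    constructor
    · intro h
      exact ⟨v, by rw [← h, hHG], rfl⟩
    · rintro ⟨u, h1, h2⟩
      rw [← h1, ← h2, hGH]
  · have h1 := hH g (G (H (g, v'), v)) v
    rw [hHG] at h1
    have h2 := hG (H (g, v'), v') (H (g, v'), v)
    rw [hGH] at h2
    simp only [sub_self, norm_zero, zero_add] at h2
    rw [norm_sub_rev v' v] at h2
    calc _ ≤ _ := h1
      _ ≤ C₁ * (C₂ * ‖v - v'‖) := mul_le_mul_of_nonneg_left h2 hC₁
      _ = _ := by ring
end

section
/- Let a, b > 0 satisfy 1/√a + 1/√b = 1 and set β = π/√b. Let f : ℝ → ℝ be given by f(s) = b·s for s ≥ 0 and f(s) = a·s for s < 0, and for p ≥ 0 define ψ_p : ℝ → ℝ by ψ_p(x) = p·sin(√b·x) for x ≤ β and ψ_p(x) = -p·(√b/√a)·sin(√a·(x - β)) for x > β. Then: (i) ψ_p(0) = ψ_p(π) = 0; (ii) ψ_p is differentiable on ℝ (in particular, its left and right derivatives at β agree and equal -p·√b); (iii) for every x ∈ (0, π) with x ≠ β, ψ_p is twice differentiable at x and ψ_p''(x) + f(ψ_p(x)) = 0; and (iv)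 ψ_p = p·ψ₁. -/
open Real

/-- Juxtaposition of eigenfunction humps: with `1/√a + 1/√b = 1`, `β = π/√b`,
`f(s) = b·s (s ≥ 0), a·s (s < 0)`, and `ψ_p` the matched juxtaposition of
`p·sin(√b·x)` on `[0, β]` and `-p·(√b/√a)·sin(√a·(x - β))` on `[β, π]`, one has:
(i) `ψ_p(0) = ψ_p(π) = 0`; (ii) `ψ_p` is differentiable on `ℝ` with `ψ_p'(β) = -p√b`;
(iii) away from `β`, `ψ_p` is twice differentiable on `(0, π)` and `ψ_p'' + f(ψ_p) = 0`;
(iv) `ψ_p = p·ψ₁`. -/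
theorem halfLine_of_solutions_pieces
    (a b : ℝ) (ha : 0 < a) (hb : 0 < b)
    (hmatch : 1 / Real.sqrt a + 1 / Real.sqrt b = 1)
    (β : ℝ) (hβ : β = π / Real.sqrt b)
    (f : ℝ → ℝ) (hf : ∀ s : ℝ, f s = if 0 ≤ s then b * s else a * s)
    (ψ : ℝ → ℝ → ℝ)
    (hψ : ∀ p x : ℝ, ψ p x =
      if x ≤ β then p * Real.sin (Real.sqrt b * x)
      else -p * (Real.sqrt b / Real.sqrt a) * Real.sin (Real.sqrt a * (x - β))) :
    ∀ p : ℝ, 0 ≤ p →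
      (ψ p 0 = 0 ∧ ψ p π = 0) ∧
      (Differentiable ℝ (ψ p) ∧ deriv (ψ p) β = -p * Real.sqrt b) ∧
      (∀ x ∈ Set.Ioo (0 : ℝ) π, x ≠ β →
        DifferentiableAt ℝ (deriv (ψ p)) x ∧
        deriv (deriv (ψ p)) x + f (ψ p x) = 0) ∧
      (∀ x : ℝ, ψ p x = p * ψ 1 x) := by
  intro p hp
  have hA : 0 < Real.sqrt a := Real.sqrt_pos.mpr ha
  have hB : 0 < Real.sqrt b := Real.sqrt_pos.mpr hb
  have hAA : Real.sqrt a * Real.sqrt a = a := Real.mul_self_sqrt ha.le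
  have hBB : Real.sqrt b * Real.sqrt b = b := Real.mul_self_sqrt hb.le
  generalize Real.sqrt a = A at *
  generalize Real.sqrt b = B at *
  have hBβ : B * β = π := by rw [hβ]; field_simp
  have hβ0 : 0 < β := by rw [hβ]; positivity
  have hAπ : A * (π - β) = π := by
    have h1 : A + B = A * B := by field_simp at hmatch; linarith
    rw [hβ]; field_simp; linear_combination -h1
  have hπβ : 0 < π - β := by
    by_contra hc
    have := mul_nonpos_of_nonneg_of_nonpos hA.le (not_lt.mp hc)
    linarith [Real.pi_pos]
  have hg : ∀ x, HasDerivAt (fun x => p * Real.sin (B * x)) (p * B * Real.cos (B * x)) x := by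
    intro x
    have := (((hasDerivAt_id' x).const_mul B).sin).const_mul p
    refine this.congr_deriv ?_
    ring
  have hg2 : ∀ x, HasDerivAt (fun x => p * B * Real.cos (B * x))
      (-(b * (p * Real.sin (B * x)))) x := by
    intro x
    have := (((hasDerivAt_id' x).const_mul B).cos).const_mul (p * B)
    refine this.congr_deriv ?_
    rw [← hBB]; ring
  have hh : ∀ x, HasDerivAt (fun x => -p * (B / A) * Real.sin (A * (x - β)))
      (-p * B * Real.cos (A * (x - β))) x := by
    intro x
    have := ((((hasDerivAt_id' x).sub_const β).const_mul A).sin).const_mul (-p * (B / A))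
    refine this.congr_deriv ?_
    field_simp
  have hh2 : ∀ x, HasDerivAt (fun x => -p * B * Real.cos (A * (x - β)))
      (-(a * (-p * (B / A) * Real.sin (A * (x - β))))) x := by
    intro x
    have := ((((hasDerivAt_id' x).sub_const β).const_mul A).cos).const_mul (-p * B)
    refine this.congr_deriv ?_
    rw [← hAA]; field_simp
  have hL : ∀ x, x < β → HasDerivAt (ψ p) (p * B * Real.cos (B * x)) x := by
    intro x hx
    refine (hg x).congr_of_eventuallyEq ?_
    filter_upwards [Iio_mem_nhds hx] with y hy
    rw [hψ, if_pos (le_of_lt hy)]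
  have hR : ∀ x, β < x → HasDerivAt (ψ p) (-p * B * Real.cos (A * (x - β))) x := by
    intro x hx
    refine (hh x).congr_of_eventuallyEq ?_
    filter_upwards [Ioi_mem_nhds hx] with y hy
    rw [hψ, if_neg (not_le.mpr hy)]
  have hM : HasDerivAt (ψ p) (-p * B) β := by
    have e1 : p * B * Real.cos (B * β) = -p * B := by rw [hBβ, Real.cos_pi]; ring
    have e2 : -p * B * Real.cos (A * (β - β)) = -p * B := by simp
    have h1 : HasDerivWithinAt (ψ p) (-p * B) (Set.Iic β) β := by
      rw [← e1]
      refine (hg β).hasDerivWithinAt.congr (fun y hy => ?_) ?_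
      · rw [hψ, if_pos (Set.mem_Iic.mp hy)]
      · rw [hψ, if_pos le_rfl]
    have h2 : HasDerivWithinAt (ψ p) (-p * B) (Set.Ici β) β := by
      have hb0 : ψ p β = -p * (B / A) * Real.sin (A * (β - β)) := by
        rw [hψ, if_pos le_rfl, hBβ]; simp
      rw [← e2]
      refine (hh β).hasDerivWithinAt.congr (fun y hy => ?_) hb0
      rcases eq_or_lt_of_le (show β ≤ y from hy) with h | h
      · rw [← h]; exact hb0
      · rw [hψ, if_neg (not_le.mpr h)]
    have h3 := h1.union h2
    rw [Set.Iic_union_Ici] at h3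
    exact hasDerivWithinAt_univ.mp h3
  refine ⟨⟨?_, ?_⟩, ⟨?_, hM.deriv⟩, ?_, ?_⟩
  · rw [hψ, if_pos hβ0.le]; simp
  · rw [hψ, if_neg (by linarith), hAπ]; simp
  · intro x
    rcases lt_trichotomy x β with h | h | h
    · exact (hL x h).differentiableAt
    · rw [h]; exact hM.differentiableAt
    · exact (hR x h).differentiableAt
  · rintro x ⟨hx0, hxπ⟩ hne
    rcases lt_or_gt_of_ne hne with h | h
    · have hd : HasDerivAt (deriv (ψ p)) (-(b * (p * Real.sin (B * x)))) x := by
        refine (hg2 x).congr_of_eventuallyEq ?_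
        filter_upwards [Iio_mem_nhds h] with y hy
        exact (hL y hy).deriv
      refine ⟨hd.differentiableAt, ?_⟩
      have hs : 0 ≤ Real.sin (B * x) := Real.sin_nonneg_of_nonneg_of_le_pi (by positivity)
        (by rw [← hBβ]; gcongr)
      rw [hd.deriv, hψ, if_pos h.le, hf, if_pos (mul_nonneg hp hs)]
      ring
    · have hd : HasDerivAt (deriv (ψ p)) (-(a * (-p * (B / A) * Real.sin (A * (x - β))))) x := by
        refine (hh2 x).congr_of_eventuallyEq ?_
        filter_upwards [Ioi_mem_nhds h] with y hy
        exact (hR y hy).deriv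
      refine ⟨hd.differentiableAt, ?_⟩
      have hs : 0 ≤ Real.sin (A * (x - β)) := Real.sin_nonneg_of_nonneg_of_le_pi
        (mul_nonneg hA.le (sub_nonneg.mpr (le_of_lt h)))
        (by rw [← hAπ]; gcongr)
      have hn : -p * (B / A) * Real.sin (A * (x - β)) ≤ 0 := by
        have : 0 ≤ p * (B / A) * Real.sin (A * (x - β)) := by positivity
        linarith
      rw [hd.deriv, hψ, if_neg (not_le.mpr h), hf]
      split_ifs with h0
      · rw [le_antisymm hn h0]; simp
      · ring
  · intro x
    rw [hψ, hψ]
    split_ifs <;> ring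
end

section
/- Let a, b > 0 satisfy 1/√a + 1/√b = 1, set β = π/√b, let f : ℝ → ℝ be given by f(s) = b·s for s ≥ 0 and f(s) = a·s for s < 0, and for p ≥ 0 let ψ_p be defined by ψ_p(x) = p·sin(√b·x) for x ≤ β and ψ_p(x) = -p·(√b/√a)·sin(√a·(x - β)) for x > β. Then ψ₁ is not identically zero on [0, π], and sup_{x ∈ [0,π]} |ψ_p(x)| = p · sup_{x ∈ [0,π]} |ψ₁(x)|. Consequently the set of solutions of the boundary value problem -u'' = f(u) on (0,π), u(0) = u(π) = 0 (solutions understood as C¹ functions, twice differentiable away from β) contains the half-line {p·ψ₁ : p ≥ 0} and is unbounded in the supremum norm. -/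
open Real

/-- Non-properness: with `1/√a + 1/√b = 1`, `β = π/√b`, `f(s) = b·s (s ≥ 0), a·s (s < 0)` and
`ψ_p` the matched juxtaposition of eigenfunction humps, `ψ₁` is not identically zero on
`[0, π]` and `sup |ψ_p| = p · sup |ψ₁|`; hence the set of solutions of `-u'' = f(u)` on
`(0, π)` with `u(0) = u(π) = 0` (C¹ solutions, twice differentiable away from `β`) contains
the half-line `{p·ψ₁ : p ≥ 0}` and is unbounded in the supremum norm. -/
theorem halfLine_of_solutions_unbounded
    (a b : ℝ) (ha : 0 < a) (hb : 0 < b)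
    (hmatch : 1 / Real.sqrt a + 1 / Real.sqrt b = 1)
    (β : ℝ) (hβ : β = π / Real.sqrt b)
    (f : ℝ → ℝ) (hf : ∀ s : ℝ, f s = if 0 ≤ s then b * s else a * s)
    (ψ : ℝ → ℝ → ℝ)
    (hψ : ∀ p x : ℝ, ψ p x =
      if x ≤ β then p * Real.sin (Real.sqrt b * x)
      else -p * (Real.sqrt b / Real.sqrt a) * Real.sin (Real.sqrt a * (x - β)))
    (S : Set (ℝ → ℝ))
    (hS : S = {u : ℝ → ℝ | u 0 = 0 ∧ u π = 0 ∧ Differentiable ℝ u ∧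
      ∀ x ∈ Set.Ioo (0 : ℝ) π, x ≠ β →
        DifferentiableAt ℝ (deriv u) x ∧ deriv (deriv u) x = -f (u x)}) :
    (∃ x ∈ Set.Icc (0 : ℝ) π, ψ 1 x ≠ 0) ∧
    (∀ p : ℝ, 0 ≤ p →
      sSup ((fun x => |ψ p x|) '' Set.Icc (0 : ℝ) π)
        = p * sSup ((fun x => |ψ 1 x|) '' Set.Icc (0 : ℝ) π)) ∧
    (∀ p : ℝ, 0 ≤ p → (fun x => p * ψ 1 x) ∈ S) ∧
    (∀ R : ℝ, ∃ u ∈ S, R ≤ sSup ((fun x => |u x|) '' Set.Icc (0 : ℝ) π)) := by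
  obtain ⟨A, hA⟩ : ∃ A, A = Real.sqrt a := ⟨_, rfl⟩
  obtain ⟨B, hB⟩ : ∃ B, B = Real.sqrt b := ⟨_, rfl⟩
  have hA0 : 0 < A := hA ▸ Real.sqrt_pos.2 ha
  have hB0 : 0 < B := hB ▸ Real.sqrt_pos.2 hb
  have haA : a = A * A := by rw [hA, Real.mul_self_sqrt ha.le]
  have hbB : b = B * B := by rw [hB, Real.mul_self_sqrt hb.le]
  rw [← hA, ← hB] at hmatch
  rw [← hB] at hβ
  simp only [← hA, ← hB] at hψ
  have hpi := Real.pi_pos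
  have hBβ : B * β = π := by rw [hβ]; field_simp
  have hβ0 : 0 < β := by rw [hβ]; positivity
  have hAπ : A * (π - β) = π := by
    rw [hβ]
    field_simp at hmatch ⊢
    linear_combination -hmatch
  have hβπ : β < π := by
    by_contra h
    have : A * (π - β) ≤ 0 := mul_nonpos_of_nonneg_of_nonpos hA0.le (by linarith)
    linarith
  have hscale : ∀ p x, ψ p x = p * ψ 1 x := by
    intro p x
    rw [hψ, hψ 1]
    split_ifs <;> ring
  -- the two branches
  have hL : ∀ x, HasDerivAt (fun x => Real.sin (B * x)) (B * Real.cos (B * x)) x := by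
    intro x
    have := ((hasDerivAt_id x).const_mul B).sin
    simp only [id, mul_one] at this
    rw [mul_comm]; exact this
  have hR : ∀ x, HasDerivAt (fun x => -(B / A) * Real.sin (A * (x - β)))
      (-B * Real.cos (A * (x - β))) x := by
    intro x
    have := ((((hasDerivAt_id x).sub_const β).const_mul A).sin).const_mul (-(B / A))
    simp only [id, mul_one] at this
    refine this.congr_deriv ?_
    field_simp
  have hL2 : ∀ x, HasDerivAt (fun x => B * Real.cos (B * x)) (-b * Real.sin (B * x)) x := by
    intro x
    have := (((hasDerivAt_id x).const_mul B).cos).const_mul B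
    simp only [id, mul_one] at this
    refine this.congr_deriv ?_
    rw [hbB]; ring
  have hR2 : ∀ x, HasDerivAt (fun x => -B * Real.cos (A * (x - β)))
      (A * B * Real.sin (A * (x - β))) x := by
    intro x
    have := ((((hasDerivAt_id x).sub_const β).const_mul A).cos).const_mul (-B)
    simp only [id, mul_one] at this
    refine this.congr_deriv ?_
    ring
  have eL : ∀ x, x ≤ β → ψ 1 x = Real.sin (B * x) := by
    intro x hx
    rw [hψ, if_pos hx, one_mul]
  have eR : ∀ x, β ≤ x → ψ 1 x = -(B / A) * Real.sin (A * (x - β)) := by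
    intro x hx
    rcases hx.eq_or_lt with rfl | h
    · rw [eL _ le_rfl, hBβ]; simp
    · rw [hψ, if_neg (not_le.2 h)]; ring
  obtain ⟨φ, hφ⟩ : ∃ φ : ℝ → ℝ, ∀ x, φ x =
    if x ≤ β then B * Real.cos (B * x) else -B * Real.cos (A * (x - β)) := ⟨_, fun _ => rfl⟩
  have hder : ∀ x, HasDerivAt (ψ 1) (φ x) x := by
    intro x
    rcases lt_trichotomy x β with h | h | h
    · rw [hφ, if_pos h.le]
      refine (hL x).congr_of_eventuallyEq ?_
      filter_upwards [Iio_mem_nhds h] with y hy using eL y (le_of_lt hy)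
    · subst h
      rw [hφ, if_pos le_rfl]
      have h1 : HasDerivWithinAt (ψ 1) (B * Real.cos (B * x)) (Set.Iic x) x :=
        (hL x).hasDerivWithinAt.congr (fun y hy => eL y hy) (eL x le_rfl)
      have h2 : HasDerivWithinAt (ψ 1) (B * Real.cos (B * x)) (Set.Ici x) x := by
        have := (hR x).hasDerivWithinAt.congr (s := Set.Ici x) (fun y hy => eR y hy) (eR x le_rfl)
        refine this.congr_deriv ?_
        rw [hBβ]; simp
      have := h1.union h2
      rwa [Set.Iic_union_Ici, hasDerivWithinAt_univ] at this
    · rw [hφ, if_neg (not_le.2 h)]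
      refine (hR x).congr_of_eventuallyEq ?_
      filter_upwards [Ioi_mem_nhds h] with y hy using eR y (le_of_lt hy)
  have hmem : ∀ p : ℝ, 0 ≤ p → (fun x => p * ψ 1 x) ∈ S := by
    intro p hp
    have hd : ∀ x, HasDerivAt (fun x => p * ψ 1 x) (p * φ x) x := fun x => (hder x).const_mul p
    have hdf : deriv (fun x => p * ψ 1 x) = fun x => p * φ x := funext fun x => (hd x).deriv
    rw [hS]
    refine ⟨?_, ?_, fun x => (hd x).differentiableAt, ?_⟩
    · simp [eL 0 hβ0.le]
    · simp [eR π hβπ.le, hAπ]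
    · intro x hx hne
      rw [hdf]
      rcases lt_or_gt_of_ne hne with h | h
      · have h1 : HasDerivAt φ (-b * Real.sin (B * x)) x := by
          refine (hL2 x).congr_of_eventuallyEq ?_
          filter_upwards [Iio_mem_nhds h] with y hy
          rw [hφ, if_pos (le_of_lt hy)]
        have h2 := h1.const_mul p
        refine ⟨h2.differentiableAt, ?_⟩
        rw [h2.deriv]; dsimp only; rw [eL x h.le, hf, if_pos]
        · ring
        · have hs : 0 ≤ Real.sin (B * x) := by
            apply Real.sin_nonneg_of_nonneg_of_le_pi
            · exact mul_nonneg hB0.le hx.1.le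
            · rw [← hBβ]; exact mul_le_mul_of_nonneg_left h.le hB0.le
          positivity
      · have h1 : HasDerivAt φ (A * B * Real.sin (A * (x - β))) x := by
          refine (hR2 x).congr_of_eventuallyEq ?_
          filter_upwards [Ioi_mem_nhds h] with y hy
          rw [hφ, if_neg (not_le.2 hy)]
        have h2 := h1.const_mul p
        refine ⟨h2.differentiableAt, ?_⟩
        have hs : 0 ≤ Real.sin (A * (x - β)) := by
          apply Real.sin_nonneg_of_nonneg_of_le_pi
          · exact mul_nonneg hA0.le (by linarith)
          · calc A * (x - β) ≤ A * (π - β) :=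
                  mul_le_mul_of_nonneg_left (by linarith [hx.2]) hA0.le
              _ = π := hAπ
        have hle : p * ψ 1 x ≤ 0 := by
          rw [eR x h.le]
          have : 0 ≤ p * ((B / A) * Real.sin (A * (x - β))) := by positivity
          linarith
        have hfa : f (p * ψ 1 x) = a * (p * ψ 1 x) := by
          rw [hf]
          split_ifs with h0
          · rw [le_antisymm hle h0]; ring
          · rfl
        rw [h2.deriv]
        show _ = -f (p * ψ 1 x)
        rw [hfa, eR x h.le, haA]
        field_simp
  have hx0 : β / 2 ∈ Set.Icc (0 : ℝ) π := ⟨by linarith, by linarith⟩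
  have hv : ψ 1 (β / 2) = 1 := by
    rw [eL _ (by linarith), show B * (β / 2) = π / 2 by rw [← hBβ]; ring, Real.sin_pi_div_two]
  have hcont : Continuous (ψ 1) := continuous_iff_continuousAt.2 fun x => (hder x).continuousAt
  refine ⟨⟨β / 2, hx0, by rw [hv]; exact one_ne_zero⟩, ?_, hmem, ?_⟩
  · intro p hp
    rw [sSup_image', sSup_image', Real.mul_iSup_of_nonneg hp]
    congr 1
    funext x
    rw [hscale p, abs_mul, abs_of_nonneg hp]
  · intro R
    refine ⟨_, hmem |R| (abs_nonneg R), ?_⟩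
    have hb : BddAbove ((fun x => |(|R| * ψ 1 x)|) '' Set.Icc (0 : ℝ) π) :=
      isCompact_Icc.bddAbove_image (by fun_prop)
    refine le_trans ?_ (le_csSup hb ⟨β / 2, hx0, rfl⟩)
    simp [hv, le_abs_self]
end

section
/- Let a < 1 < b and let f : ℝ → ℝ be given by f(s) = b·s for s ≥ 0 and f(s) = a·s for s < 0. Suppose u : ℝ → ℝ is continuously differentiable on [0, π], u(0) = u(π) = 0, and there is a finite set S ⊂ (0, π) such that for every x ∈ (0, π) \ S the derivative u' is differentiable at x with (u')'(x) = -f(u(x)). Then u(x) = 0 for all x ∈ [0, π]. -/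
open Real

/-- In the Ambrosetti–Prodi position `a < 1 < b`, the piecewise-linear problem has no
nontrivial solution: if `u` is C¹ on `[0, π]`, vanishes at `0` and `π`, and satisfies
`u'' = -f(u)` on `(0, π)` away from a finite set `S`, where `f(s) = b·s (s ≥ 0), a·s (s < 0)`,
then `u` vanishes identically on `[0, π]`. -/
theorem no_nontrivial_kernel_AP
    (a b : ℝ) (ha : a < 1) (hb : 1 < b)
    (f : ℝ → ℝ) (hf : ∀ s : ℝ, f s = if 0 ≤ s then b * s else a * s)
    (u : ℝ → ℝ) (hu : ContDiffOn ℝ 1 u (Set.Icc 0 π))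
    (h0 : u 0 = 0) (hπ : u π = 0)
    (S : Set ℝ) (hSfin : S.Finite) (hSsub : S ⊆ Set.Ioo 0 π)
    (hode : ∀ x ∈ Set.Ioo (0 : ℝ) π, x ∉ S →
      DifferentiableAt ℝ (deriv u) x ∧ deriv (deriv u) x = -f (u x)) :
    ∀ x ∈ Set.Icc (0 : ℝ) π, u x = 0 := by
  have hπ0 : (0 : ℝ) < π := Real.pi_pos
  have hfc : ∀ s, f s = b * max s 0 + a * min s 0 := by
    intro s
    rw [hf]
    split_ifs with h
    · simp [h]
    · have h' : s ≤ 0 := (not_le.mp h).le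
      simp [h']
  have hfcont : Continuous f := by
    have : f = fun s => b * max s 0 + a * min s 0 := funext hfc
    rw [this]
    fun_prop
  have huc : ContinuousOn u (Set.Icc 0 π) := hu.continuousOn
  have hvc : ContinuousOn (derivWithin u (Set.Icc 0 π)) (Set.Icc 0 π) :=
    hu.continuousOn_derivWithin (uniqueDiffOn_Icc hπ0) le_rfl
  have hfpos : ∀ s, 0 ≤ f s - s := by
    intro s
    rw [hf]
    split_ifs with h
    · nlinarith
    · nlinarith [not_le.mp h]
  have hfpos' : ∀ s, s ≠ 0 → 0 < f s - s := by
    intro s hs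
    rw [hf]
    split_ifs with h
    · nlinarith [lt_of_le_of_ne h hs.symm]
    · nlinarith [not_le.mp h]
  have hgc : ContinuousOn (fun x => (f (u x) - u x) * Real.sin x) (Set.Icc 0 π) :=
    ((hfcont.comp_continuousOn huc).sub huc).mul Real.continuous_sin.continuousOn
  have hint : ∫ x in (0 : ℝ)..π, (f (u x) - u x) * Real.sin x = 0 := by
    have key := MeasureTheory.integral_eq_of_hasDerivAt_off_countable_of_le
      (fun x => u x * Real.cos x - derivWithin u (Set.Icc 0 π) x * Real.sin x)
      (fun x => (f (u x) - u x) * Real.sin x) hπ0.le hSfin.countable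
      ((huc.mul Real.continuous_cos.continuousOn).sub
        (hvc.mul Real.continuous_sin.continuousOn)) ?_
      (hgc.intervalIntegrable_of_Icc hπ0.le)
    · rw [key]
      simp [h0, hπ]
    · rintro x ⟨hx, hxS⟩
      obtain ⟨hd, he⟩ := hode x hx hxS
      have hnhds : Set.Icc 0 π ∈ nhds x := Icc_mem_nhds hx.1 hx.2
      have hev : derivWithin u (Set.Icc 0 π) =ᶠ[nhds x] deriv u := by
        filter_upwards [Ioo_mem_nhds hx.1 hx.2] with y hy
        exact derivWithin_of_mem_nhds (Icc_mem_nhds hy.1 hy.2)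
      have h1 : HasDerivAt u (deriv u x) x :=
        ((hu.differentiableOn one_ne_zero).differentiableAt hnhds).hasDerivAt
      have h2 : HasDerivAt (derivWithin u (Set.Icc 0 π)) (-f (u x)) x := by
        have := hd.hasDerivAt
        rw [he] at this
        exact this.congr_of_eventuallyEq hev
      have h3 := (h1.mul (Real.hasDerivAt_cos x)).sub (h2.mul (Real.hasDerivAt_sin x))
      refine h3.congr_deriv ?_
      rw [hev.eq_of_nhds]
      ring
  intro x hx
  by_contra hne
  have hx0 : x ≠ 0 := fun h => hne (h ▸ h0)
  have hxπ : x ≠ π := fun h => hne (h ▸ hπ)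
  have hpos := intervalIntegral.integral_pos hπ0 hgc
    (fun y hy => mul_nonneg (hfpos _) (Real.sin_nonneg_of_nonneg_of_le_pi hy.1.le hy.2))
    ⟨x, hx, mul_pos (hfpos' _ hne) (Real.sin_pos_of_pos_of_lt_pi
      (lt_of_le_of_ne hx.1 hx0.symm) (lt_of_le_of_ne hx.2 hxπ))⟩
  exact absurd hint hpos.ne'
end

section
/- Let f : ℝ → ℝ be positively homogeneous, i.e., f(c·s) = c·f(s) for all c ≥ 0 and s ∈ ℝ, and let ψ : ℝ → ℝ be twice differentiable on (0, π) with ψ''(y) + f(ψ(y)) = 0 for all y ∈ (0, π) and ψ(0) = ψ(π) = 0. Define u : ℝ × ℝ → ℝ by u(x, y) = sin(x)·ψ(y). Then u vanishes on the boundary of the square [0, π] × [0, π], and for every (x, y) ∈ (0, π) × (0, π), the second partial derivatives of u satisfy ∂²u/∂x²(x,y) + ∂²u/∂y²(x,y) + f(u(x,y)) + u(x,y) = 0; that is, u solves -Δu = f̃(u) with Dirichlet conditions on (0,π)², where f̃(s) = f(s) + s. -/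
open Real

/-- Separation of variables: if `f` is positively homogeneous and `ψ` solves
`ψ'' + f(ψ) = 0` on `(0, π)` with `ψ(0) = ψ(π) = 0`, then `u(x,y) = sin(x)·ψ(y)` vanishes on
the boundary of the square `[0, π]²` and solves `Δu + f(u) + u = 0` on `(0, π)²`, i.e.
`-Δu = f̃(u)` with `f̃(s) = f(s) + s`. -/
theorem separation_of_variables_square
    (f : ℝ → ℝ) (hhom : ∀ c : ℝ, 0 ≤ c → ∀ s : ℝ, f (c * s) = c * f s)
    (ψ : ℝ → ℝ)
    (hψ0 : ψ 0 = 0) (hψπ : ψ π = 0)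
    (hψ : ∀ y ∈ Set.Ioo (0 : ℝ) π,
      DifferentiableAt ℝ ψ y ∧ DifferentiableAt ℝ (deriv ψ) y ∧
        deriv (deriv ψ) y + f (ψ y) = 0) :
    (∀ x ∈ Set.Icc (0 : ℝ) π, ∀ y ∈ Set.Icc (0 : ℝ) π,
      (x = 0 ∨ x = π ∨ y = 0 ∨ y = π) → Real.sin x * ψ y = 0) ∧
    (∀ x ∈ Set.Ioo (0 : ℝ) π, ∀ y ∈ Set.Ioo (0 : ℝ) π,
      deriv (deriv (fun x' => Real.sin x' * ψ y)) x
        + deriv (deriv (fun y' => Real.sin x * ψ y')) y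
        + f (Real.sin x * ψ y) + Real.sin x * ψ y = 0) := by
  refine ⟨?_, ?_⟩
  · rintro x - y - (rfl | rfl | rfl | rfl)
    · simp
    · simp
    · simp [hψ0]
    · simp [hψπ]
  · intro x hx y hy
    obtain ⟨-, -, h⟩ := hψ y hy
    have h1 : deriv (fun x' => Real.sin x' * ψ y) = fun x' => Real.cos x' * ψ y := by
      funext t
      exact ((Real.hasDerivAt_sin t).mul_const (ψ y)).deriv
    have h2 : deriv (fun x' => Real.cos x' * ψ y) x = -Real.sin x * ψ y :=
      ((Real.hasDerivAt_cos x).mul_const (ψ y)).deriv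
    have h3 : deriv (fun y' => Real.sin x * ψ y') = fun y' => Real.sin x * deriv ψ y' := by
      funext t
      exact deriv_const_mul_field (Real.sin x)
    have h4 : deriv (fun y' => Real.sin x * deriv ψ y') y = Real.sin x * deriv (deriv ψ) y :=
      deriv_const_mul_field (Real.sin x)
    rw [h1, h2, h3, h4, hhom _ (Real.sin_pos_of_mem_Ioo hx).le]
    linear_combination Real.sin x * h
end
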